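/- arXiv:1712.03789 — 12 statements merged into one kernel-verified Lean document; each statement's English description precedes it below -/
import Mathlib

section
/- Let m ≥ 2 be an integer, let λ, k be real numbers and a a nonzero real number. If p₁ > 0 and p₂ > 0 satisfy (λ/(m+2))(p₁ + p₂) = a p₁^{−m−1} + a p₂^{−m−1} and (λ/(m+2))p_i² + (2a/m)p_i^{−m} = k for i = 1, 2, then p₁ = p₂. -/
/-- The trapezoidal rule strictly overestimates `∫ t in x..y, t ^ (-m - 1)`, with denominators
cleared. -/
theorem two_mul_mul_pow_sub_pow_lt {x y : ℝ} (hx : 0 < x) (hxy : x < y) {m : ℕ} (hm : 1 ≤ m) :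
    2 * (x * y) * (y ^ m - x ^ m) < m * ((y - x) * (x ^ (m + 1) + y ^ (m + 1))) := by
  have hd : 0 < y - x := sub_pos.2 hxy
  induction m, hm using Nat.le_induction with
  | base =>
    have h := pow_pos hd 3
    norm_num
    nlinarith
  | succ m _ ih =>
    have hpow : 0 ≤ y ^ (m + 1) - x ^ (m + 1) :=
      sub_nonneg.2 (pow_le_pow_left₀ hx.le hxy.le _)
    have hstep := mul_lt_mul_of_pos_left ih (show 0 < (x + y) / 2 by linarith)
    have hgap : 0 ≤ ((m : ℝ) / 2 + 1) * ((y - x) ^ 2 * (y ^ (m + 1) - x ^ (m + 1))) := by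
      positivity
    push_cast
    simp only [pow_succ] at *
    linarith

theorem zpow_neg_sub_lt_trapezoid {x y : ℝ} (hx : 0 < x) (hxy : x < y) {m : ℕ} (hm : 1 ≤ m) :
    2 * (x ^ (-(m : ℤ)) - y ^ (-(m : ℤ))) <
      m * ((y - x) * (x ^ (-(m : ℤ) - 1) + y ^ (-(m : ℤ) - 1))) := by
  have hy : 0 < y := hx.trans hxy
  have key := two_mul_mul_pow_sub_pow_lt hx hxy hm
  have hpos : 0 < x ^ (m + 1) * y ^ (m + 1) := by positivity
  have hexp : -(m : ℤ) - 1 = -((m + 1 : ℕ) : ℤ) := by push_cast; ring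
  rw [hexp]
  simp only [zpow_neg, zpow_natCast]
  refine lt_of_mul_lt_mul_left ?_ hpos.le
  calc
    _ = 2 * (x * y) * (y ^ m - x ^ m) := by field_simp; ring
    _ < m * ((y - x) * (x ^ (m + 1) + y ^ (m + 1))) := key
    _ = _ := by field_simp; ring

/-- The two relations force equality in the trapezoidal rule, so the arguments cannot differ. -/
theorem not_lt_of_trapezoid_relations {m : ℕ} (hm : 1 ≤ m) {c k a x y : ℝ} (ha : a ≠ 0)
    (hx : 0 < x)
    (h1 : c * (x + y) = a * x ^ (-(m : ℤ) - 1) + a * y ^ (-(m : ℤ) - 1))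
    (h2 : c * x ^ 2 + 2 * a / (m : ℝ) * x ^ (-(m : ℤ)) = k)
    (h3 : c * y ^ 2 + 2 * a / (m : ℝ) * y ^ (-(m : ℤ)) = k) : ¬x < y := by
  intro hxy
  have hm0 : (m : ℝ) ≠ 0 := by positivity
  refine (zpow_neg_sub_lt_trapezoid hx hxy hm).ne (mul_left_cancel₀ ha ?_)
  field_simp at h2 h3
  linear_combination h2 - h3 + m * (y - x) * h1


/-- If `m ≥ 2`, `a ≠ 0`, and `p₁, p₂ > 0` satisfy
`(λ/(m+2))(p₁+p₂) = a p₁^(−m−1) + a p₂^(−m−1)` and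
`(λ/(m+2)) pᵢ² + (2a/m) pᵢ^(−m) = k` for `i = 1, 2`, then `p₁ = p₂`. -/
theorem stmt_1 (m : ℕ) (hm : 2 ≤ m) (lam k a : ℝ) (ha : a ≠ 0)
    (p₁ p₂ : ℝ) (hp₁ : 0 < p₁) (hp₂ : 0 < p₂)
    (h1 : lam / ((m : ℝ) + 2) * (p₁ + p₂) = a * p₁ ^ (-(m : ℤ) - 1) + a * p₂ ^ (-(m : ℤ) - 1))
    (h2 : lam / ((m : ℝ) + 2) * p₁ ^ 2 + 2 * a / (m : ℝ) * p₁ ^ (-(m : ℤ)) = k)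
    (h3 : lam / ((m : ℝ) + 2) * p₂ ^ 2 + 2 * a / (m : ℝ) * p₂ ^ (-(m : ℤ)) = k) :
    p₁ = p₂ := by
  exact le_antisymm
    (not_lt.1 (not_lt_of_trapezoid_relations (by omega) ha hp₂ (by linarith) h3 h2))
    (not_lt.1 (not_lt_of_trapezoid_relations (by omega) ha hp₁ h1 h2 h3))
end

section
/- Let m ≥ 2 be an integer, a > 0, ρ ≤ 0. Suppose p : ℝ → ℝ is twice differentiable, p(s) > 0 for all s, and p''(s) = a·p(s)^{−m} − ρ·p(s) for all s ∈ ℝ. Then there exists exactly one s₀ ∈ ℝ with p'(s₀) = 0. -/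
/-- A function whose derivative is at least `c > 0` on `(-∞, 0)` takes a nonpositive value. -/
theorem exists_nonpos_of_le_deriv {g : ℝ → ℝ} (hg : Differentiable ℝ g) {c : ℝ} (hc : 0 < c)
    (h : ∀ s < 0, c ≤ deriv g s) : ∃ s, g s ≤ 0 := by
  by_contra! hpos
  have hle : -(g 0 / c) ≤ 0 := by have := div_pos (hpos 0) hc; linarith
  have key := (convex_Iic (0 : ℝ)).mul_sub_le_image_sub_of_le_deriv hg.continuous.continuousOn
    hg.differentiableOn (C := c) (fun x hx => h x (by simpa using hx)) _ hle 0 Set.self_mem_Iic hle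
  have hmul : c * (0 - -(g 0 / c)) = g 0 := by field_simp; ring
  linarith [hpos (-(g 0 / c))]

/-- If `p > 0` and `p''` is bounded below by `a p^(-m)` with `a > 0`, then `p'` takes a
nonpositive value. -/
theorem exists_deriv_nonpos {m : ℕ} {a : ℝ} (ha : 0 < a) {p : ℝ → ℝ}
    (hp' : Differentiable ℝ (deriv p)) (hpos : ∀ s, 0 < p s)
    (h : ∀ s, a * p s ^ (-(m : ℤ)) ≤ deriv (deriv p) s) : ∃ s, deriv p s ≤ 0 := by
  by_contra! hd
  obtain ⟨s, hs⟩ := exists_nonpos_of_le_deriv hp' (c := a * p 0 ^ (-(m : ℤ)))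
    (mul_pos ha (zpow_pos (hpos 0) _)) fun s hs => by
      refine le_trans ?_ (h s)
      have hle : p s ≤ p 0 := (strictMono_of_deriv_pos hd).monotone hs.le
      have := hpos s
      simp only [zpow_neg, zpow_natCast]
      gcongr
  exact (hd s).not_ge hs

/-- For `m ≥ 2`, `a > 0`, `ρ ≤ 0`: if `p : ℝ → ℝ` is twice differentiable, positive,
and satisfies `p'' = a p^(−m) − ρ p` on `ℝ`, then `p'` has exactly one root. -/
theorem stmt_4 (m : ℕ) (hm : 2 ≤ m) (a ρ : ℝ) (ha : 0 < a) (hρ : ρ ≤ 0)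
    (p : ℝ → ℝ)
    (hdiff : ∀ s : ℝ, DifferentiableAt ℝ p s)
    (hdiff2 : ∀ s : ℝ, DifferentiableAt ℝ (deriv p) s)
    (hpos : ∀ s : ℝ, 0 < p s)
    (hode : ∀ s : ℝ, deriv (deriv p) s = a * (p s) ^ (-(m : ℤ)) - ρ * p s) :
    ∃! s₀ : ℝ, deriv p s₀ = 0 := by
  have h : ∀ s, a * p s ^ (-(m : ℤ)) ≤ deriv (deriv p) s := fun s => by
    rw [hode]
    have := mul_nonneg (neg_nonneg.mpr hρ) (hpos s).le
    linarith
  have hmono : StrictMono (deriv p) := strictMono_of_deriv_pos fun s =>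
    (mul_pos ha (zpow_pos (hpos s) _)).trans_le (h s)
  obtain ⟨x, hx⟩ := exists_deriv_nonpos ha hdiff2 hpos h
  have hrefl : deriv (fun s => p (-s)) = fun s => -deriv p (-s) :=
    funext fun s => deriv_comp_neg p s
  have hrefl2 : ∀ s, deriv (deriv fun s => p (-s)) s = deriv (deriv p) (-s) := fun s => by
    rw [hrefl, deriv.fun_neg, deriv_comp_neg (deriv p), neg_neg]
  have hp' : Differentiable ℝ (deriv p) := hdiff2
  obtain ⟨y, hy⟩ := exists_deriv_nonpos (p := fun s => p (-s)) ha
    (by rw [hrefl]; fun_prop) (fun s => hpos (-s)) (fun s => (h (-s)).trans_eq (hrefl2 s).symm)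
  rw [hrefl] at hy
  obtain ⟨s₀, hs₀⟩ := mem_range_of_exists_le_of_exists_ge hp'.continuous
    ⟨x, hx⟩ ⟨-y, neg_nonpos.mp hy⟩
  exact ⟨s₀, hs₀, fun t ht => hmono.injective (ht.trans hs₀.symm)⟩
end

section
/- Let m ≥ 2 be an integer, a > 0, ρ ≤ 0, μ ∈ ℝ, and let α < β be real numbers. Suppose p : (α, β) → ℝ is differentiable, p(s) > 0 for all s ∈ (α, β), and (p'(s))² + ρ·p(s)² + (2a/(m−1))·p(s)^{1−m} = μ/(m−1) on (α, β). Then there exist constants 0 < c ≤ C and D > 0 such that c ≤ p(s) ≤ C and |p'(s)| ≤ D for all s ∈ (α, β). -/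
/-- A positive function whose derivative grows at most linearly is bounded above on a bounded
interval. -/
theorem exists_le_of_abs_deriv_le_mul_one_add {p : ℝ → ℝ} {α β L : ℝ}
    (hdiff : ∀ s ∈ Set.Ioo α β, DifferentiableAt ℝ p s)
    (hpos : ∀ s ∈ Set.Ioo α β, 0 < p s)
    (hL : ∀ s ∈ Set.Ioo α β, |deriv p s| ≤ L * (1 + p s)) :
    ∃ C : ℝ, ∀ s ∈ Set.Ioo α β, p s ≤ C := by
  rcases (Set.Ioo α β).eq_empty_or_nonempty with h | ⟨x, hx⟩
  · exact ⟨0, by simp [h]⟩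
  have hL0 : 0 ≤ L := by
    have := (abs_nonneg _).trans (hL x hx)
    exact nonneg_of_mul_nonneg_left this (by linarith [hpos x hx])
  refine ⟨Real.exp (Real.log (1 + p x) + L * (β - α)), fun s hs => ?_⟩
  have hlog : ∀ t ∈ Set.Ioo α β, HasDerivWithinAt (fun u => Real.log (1 + p u))
      (deriv p t / (1 + p t)) (Set.Ioo α β) t := fun t ht =>
    (((hdiff t ht).hasDerivAt.const_add 1).log
      (by linarith [hpos t ht])).hasDerivWithinAt
  have hbound : ∀ t ∈ Set.Ioo α β, ‖deriv p t / (1 + p t)‖ ≤ L := fun t ht => by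
    have h1 : 0 < 1 + p t := by linarith [hpos t ht]
    rw [Real.norm_eq_abs, abs_div, abs_of_pos h1, div_le_iff₀ h1]
    exact hL t ht
  have hlip := (convex_Ioo α β).norm_image_sub_le_of_norm_hasDerivWithin_le hlog hbound hx hs
  have hsx : ‖s - x‖ ≤ β - α := by
    rw [Real.norm_eq_abs, abs_le]
    constructor <;> linarith [hx.1, hx.2, hs.1, hs.2]
  have hle : Real.log (1 + p s) ≤ Real.log (1 + p x) + L * (β - α) := by
    have h1 := (le_abs_self _).trans hlip
    have h2 := mul_le_mul_of_nonneg_left hsx hL0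
    linarith
  have h1 := (Real.log_le_iff_le_exp (by linarith [hpos s hs])).1 hle
  linarith

/-- A bound on a negative power of a positive number bounds the number from below. -/
theorem min_one_div_le_of_mul_zpow_le {m : ℕ} (hm : 2 ≤ m) {x k K : ℝ} (hx : 0 < x)
    (hk : 0 < k) (hK : 0 < K) (h : x < 1 → k * x ^ ((1 : ℤ) - (m : ℤ)) ≤ K) :
    min 1 (k / K) ≤ x := by
  rcases le_or_gt 1 x with hx1 | hx1
  · exact (min_le_left _ _).trans hx1
  refine (min_le_right _ _).trans ?_
  have h1 : x⁻¹ ≤ x ^ ((1 : ℤ) - (m : ℤ)) := by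
    rw [← zpow_neg_one]
    exact zpow_le_zpow_right_of_le_one₀ hx hx1.le (by omega)
  have h2 := (mul_le_mul_of_nonneg_left h1 hk.le).trans (h hx1)
  rw [← div_eq_mul_inv, div_le_iff₀ hx] at h2
  rw [div_le_iff₀ hK]
  linarith

/-- For `m ≥ 2`, `a > 0`, `ρ ≤ 0`, `μ ∈ ℝ` and `α < β`: any positive differentiable solution
`p` of `(p')² + ρ p² + (2a/(m−1)) p^(1−m) = μ/(m−1)` on `(α, β)` satisfies uniform two-sided
bounds `0 < c ≤ p ≤ C` and a uniform gradient bound `|p'| ≤ D` on `(α, β)`. -/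
theorem stmt_5 (m : ℕ) (hm : 2 ≤ m) (a ρ μ α β : ℝ) (ha : 0 < a) (hρ : ρ ≤ 0) (hαβ : α < β)
    (p : ℝ → ℝ)
    (hdiff : ∀ s ∈ Set.Ioo α β, DifferentiableAt ℝ p s)
    (hpos : ∀ s ∈ Set.Ioo α β, 0 < p s)
    (hode : ∀ s ∈ Set.Ioo α β,
      (deriv p s) ^ 2 + ρ * (p s) ^ 2 + 2 * a / ((m : ℝ) - 1) * (p s) ^ ((1 : ℤ) - (m : ℤ))
        = μ / ((m : ℝ) - 1)) :
    ∃ c C D : ℝ, 0 < c ∧ c ≤ C ∧ 0 < D ∧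
      ∀ s ∈ Set.Ioo α β, c ≤ p s ∧ p s ≤ C ∧ |deriv p s| ≤ D := by
  have hm1 : (0 : ℝ) < (m : ℝ) - 1 := by
    have : (2 : ℝ) ≤ m := by exact_mod_cast hm
    linarith
  have hk : 0 < 2 * a / ((m : ℝ) - 1) := by positivity
  generalize 2 * a / ((m : ℝ) - 1) = k at hk hode
  generalize μ / ((m : ℝ) - 1) = M at hode
  set L : ℝ := |M| - ρ + 1 with hLdef
  have hM := le_abs_self M
  have hM0 := abs_nonneg M
  have hL1 : 1 ≤ L := by linarith
  have hlower : ∀ s ∈ Set.Ioo α β, min 1 (k / L) ≤ p s := fun s hs => by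
    have hp := hpos s hs
    refine min_one_div_le_of_mul_zpow_le hm hp hk (by linarith) fun h1 => ?_
    nlinarith [hode s hs, sq_nonneg (deriv p s), mul_nonneg (neg_nonneg.2 hρ)
      (show 0 ≤ 1 - p s ^ 2 by nlinarith)]
  have hderiv : ∀ s ∈ Set.Ioo α β, |deriv p s| ≤ L * (1 + p s) := fun s hs => by
    have hp := hpos s hs
    have hz : 0 < k * p s ^ ((1 : ℤ) - (m : ℤ)) := mul_pos hk (zpow_pos hp _)
    refine abs_le_of_sq_le_sq ?_ (by positivity)
    have h1 : (deriv p s) ^ 2 ≤ L * (1 + p s) ^ 2 := by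
      nlinarith [hode s hs, mul_nonneg hM0 hp.le, mul_nonneg hM0 (sq_nonneg (p s)),
        mul_nonneg (neg_nonneg.2 hρ) hp.le, sq_nonneg (p s)]
    have h2 : L * (1 + p s) ^ 2 ≤ L ^ 2 * (1 + p s) ^ 2 :=
      mul_le_mul_of_nonneg_right (by nlinarith) (sq_nonneg _)
    rw [mul_pow]
    exact h1.trans h2
  obtain ⟨C, hC⟩ := exists_le_of_abs_deriv_le_mul_one_add hdiff hpos hderiv
  obtain ⟨x, hx⟩ := Set.nonempty_Ioo.2 hαβ
  have hC0 : 0 < C := (hpos x hx).trans_le (hC x hx)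
  exact ⟨min 1 (k / L), C, L * (1 + C), lt_min one_pos (by positivity),
    (hlower x hx).trans (hC x hx), by positivity, fun s hs => ⟨hlower s hs, hC s hs,
      (hderiv s hs).trans (mul_le_mul_of_nonneg_left (by linarith [hC s hs]) (by linarith))⟩⟩
end

section
/- Let m ≥ 2 be an integer, a < 0, ρ < 0, and set ρ₀ := (a/ρ)^{1/(m+1)} and κ₀ := (m+1)ρρ₀². Let J ⊆ ℝ be an interval containing 0 and suppose p : J → ℝ is twice differentiable, p > 0, p(0) > ρ₀, and p satisfies both (p')² + ρp² + (2a/(m−1))p^{1−m} = κ₀/(m−1) and p'' + ρp = a p^{−m} on J. Then p(s) > ρ₀ for all s ∈ J, and p'(s) ≠ 0 for all s ∈ J. -/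
open Set

/-- The polynomial `n x^(n+2) - (n+2) r² x^n + 2 r^(n+2)` has a double root at `r`, with a
cofactor that is positive on the positive half-line. -/
theorem exists_pos_cofactor_of_double_root (r : ℝ) (hr : 0 < r) (k : ℕ) :
    ∃ Q : ℝ → ℝ, Continuous Q ∧ (∀ x, 0 < x → 0 < Q x) ∧
      ∀ x, ((k : ℝ) + 1) * x ^ (k + 3) - ((k : ℝ) + 3) * r ^ 2 * x ^ (k + 1) + 2 * r ^ (k + 3)
        = (x - r) ^ 2 * Q x := by
  induction k with
  | zero =>
    refine ⟨fun x => x + 2 * r, by fun_prop, fun x hx => by positivity, fun x => ?_⟩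
    push_cast
    ring
  | succ k ih =>
    obtain ⟨Q, hc, hp, hQ⟩ := ih
    let S : ℕ → ℝ → ℝ := fun n x => ∑ i ∈ Finset.range n, x ^ i * r ^ (n - 1 - i)
    have hS : ∀ n x, S n x * (x - r) = x ^ n - r ^ n := fun n x =>
      (Commute.all x r).geom_sum₂_mul n
    have hS0 : ∀ n x, 0 < x → 0 ≤ S n x := fun n x hx =>
      Finset.sum_nonneg fun i _ => by positivity
    have hSc : ∀ n, Continuous (S n) := fun n => by fun_prop
    refine ⟨fun x => x * Q x + (S (k + 3) x + r * S (k + 2) x), by fun_prop, fun x hx => ?_,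
      fun x => ?_⟩
    · have h1 := hS0 (k + 3) x hx
      have h2 := hS0 (k + 2) x hx
      have h3 := hp x hx
      positivity
    · push_cast
      linear_combination x * hQ x - (x - r) * hS (k + 3) x - (x - r) * r * hS (k + 2) x

/-- A function with `|f'| ≤ K |f|` between `a` and `b` that vanishes at `a` vanishes at `b`. -/
theorem eq_zero_of_abs_deriv_le_of_eq_zero_uIcc {f : ℝ → ℝ} {K a b : ℝ}
    (hf : ∀ x ∈ uIcc a b, DifferentiableAt ℝ f x) (ha : f a = 0)
    (bound : ∀ x ∈ uIcc a b, |deriv f x| ≤ K * |f x|) : f b = 0 := by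
  rcases le_total a b with hab | hab
  · rw [uIcc_of_le hab] at hf bound
    exact eq_zero_of_abs_deriv_le_mul_abs_self_of_eq_zero_right
      (fun x hx => (hf x hx).continuousAt.continuousWithinAt)
      (fun x hx => (hf x (Ico_subset_Icc_self hx)).hasDerivAt.hasDerivWithinAt) ha
      (fun x hx => bound x (Ico_subset_Icc_self hx)) b ⟨hab, le_rfl⟩
  · rw [uIcc_of_ge hab] at hf bound
    have hmem : ∀ x ∈ Icc (-a) (-b), -x ∈ Icc b a := fun x hx =>
      ⟨by linarith [hx.2], by linarith [hx.1]⟩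
    have hd : ∀ x ∈ Icc (-a) (-b), HasDerivAt (fun y => f (-y)) (-deriv f (-x)) x := by
      intro x hx
      simpa [Function.comp_def] using (hf _ (hmem x hx)).hasDerivAt.comp x (hasDerivAt_neg x)
    simpa using eq_zero_of_abs_deriv_le_mul_abs_self_of_eq_zero_right (K := K)
      (fun x hx => (hd x hx).continuousAt.continuousWithinAt)
      (fun x hx => (hd x (Ico_subset_Icc_self hx)).hasDerivWithinAt) (by simpa using ha)
      (fun x hx => by simpa using bound _ (hmem x (Ico_subset_Icc_self hx)))
      (-b) ⟨neg_le_neg hab, le_rfl⟩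

/-- If `p'² = (p - r)² R(p)` with `R` continuous on the positive half-line and `p > 0`, then `p`
cannot reach `r` unless it equals `r` everywhere. -/
theorem eq_of_deriv_sq_eq_sub_sq_mul {p R : ℝ → ℝ} {r a b : ℝ} (hR : ContinuousOn R (Ioi 0))
    (hp : ∀ x ∈ uIcc a b, DifferentiableAt ℝ p x) (hpos : ∀ x ∈ uIcc a b, 0 < p x)
    (hode : ∀ x ∈ uIcc a b, deriv p x ^ 2 = (p x - r) ^ 2 * R (p x)) (ha : p a = r) :
    p b = r := by
  have hcont : ContinuousOn (fun x => R (p x)) (uIcc a b) :=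
    hR.comp (fun x hx => (hp x hx).continuousAt.continuousWithinAt) hpos
  obtain ⟨C, hC⟩ := isCompact_uIcc.exists_bound_of_continuousOn hcont
  refine sub_eq_zero.mp (eq_zero_of_abs_deriv_le_of_eq_zero_uIcc (f := fun x => p x - r)
    (K := √C) (fun x hx => (hp x hx).sub_const r) (by simp [ha]) fun x hx => ?_)
  rw [deriv_sub_const, ← Real.sqrt_sq_eq_abs, ← Real.sqrt_sq_eq_abs,
    ← Real.sqrt_mul' _ (sq_nonneg _), hode x hx, mul_comm]
  exact Real.sqrt_le_sqrt
    (mul_le_mul_of_nonneg_right ((le_abs_self _).trans (hC x hx)) (sq_nonneg _))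


/-- For `m ≥ 2`, `a < 0`, `ρ < 0`, with `ρ₀ := (a/ρ)^(1/(m+1))` and `κ₀ := (m+1)ρρ₀²`:
if `J` is an interval containing `0`, `p` is twice differentiable, positive, `p(0) > ρ₀`,
and `p` satisfies `(p')² + ρ p² + (2a/(m−1)) p^(1−m) = κ₀/(m−1)` and `p'' + ρ p = a p^(−m)`
on `J`, then `p > ρ₀` and `p' ≠ 0` on `J`. -/
theorem stmt_6 (m : ℕ) (hm : 2 ≤ m) (a ρ : ℝ) (ha : a < 0) (hρ : ρ < 0)
    (ρ₀ : ℝ) (hρ₀ : ρ₀ = (a / ρ) ^ ((1 : ℝ) / ((m : ℝ) + 1)))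
    (κ₀ : ℝ) (hκ₀ : κ₀ = ((m : ℝ) + 1) * ρ * ρ₀ ^ 2)
    (J : Set ℝ) (hJ : J.OrdConnected) (h0 : (0 : ℝ) ∈ J)
    (p : ℝ → ℝ)
    (hdiff : ∀ s ∈ J, DifferentiableAt ℝ p s)
    (hdiff2 : ∀ s ∈ J, DifferentiableAt ℝ (deriv p) s)
    (hpos : ∀ s ∈ J, 0 < p s)
    (hinit : p 0 > ρ₀)
    (hode1 : ∀ s ∈ J,
      (deriv p s) ^ 2 + ρ * (p s) ^ 2 + 2 * a / ((m : ℝ) - 1) * (p s) ^ ((1 : ℤ) - (m : ℤ))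
        = κ₀ / ((m : ℝ) - 1))
    (hode2 : ∀ s ∈ J, deriv (deriv p) s + ρ * p s = a * (p s) ^ (-(m : ℤ))) :
    (∀ s ∈ J, ρ₀ < p s) ∧ (∀ s ∈ J, deriv p s ≠ 0) := by
  obtain ⟨k, rfl⟩ : ∃ k, m = k + 2 := ⟨m - 2, by omega⟩
  have hr : 0 < ρ₀ := hρ₀ ▸ Real.rpow_pos_of_pos (div_pos_of_neg_of_neg ha hρ) _
  have haρ : a = ρ * ρ₀ ^ (k + 3) := by
    have h : ρ₀ ^ (k + 3) = a / ρ := by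
      rw [hρ₀, one_div, ← Nat.cast_add_one]
      exact Real.rpow_inv_natCast_pow (div_pos_of_neg_of_neg ha hρ).le (by omega)
    rw [h, mul_div_cancel₀ _ hρ.ne]
  obtain ⟨Q, hQc, hQpos, hQ⟩ := exists_pos_cofactor_of_double_root ρ₀ hr k
  let R : ℝ → ℝ := fun x => -ρ / ((k : ℝ) + 1) * Q x / x ^ (k + 1)
  have hode : ∀ s ∈ J, deriv p s ^ 2 = (p s - ρ₀) ^ 2 * R (p s) := by
    intro s hs
    have hx := hpos s hs
    have h1 := hode1 s hs
    have hk : (k : ℝ) + 1 ≠ 0 := by positivity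
    have hz : p s ^ ((1 : ℤ) - ((k + 2 : ℕ) : ℤ)) = (p s ^ (k + 1))⁻¹ := by
      rw [← zpow_natCast, ← zpow_neg]
      congr 1
    have hm1 : ((k + 2 : ℕ) : ℝ) - 1 = k + 1 := by push_cast; ring
    have hR : (p s - ρ₀) ^ 2 * R (p s)
        = -ρ / ((k : ℝ) + 1) * ((p s - ρ₀) ^ 2 * Q (p s)) / p s ^ (k + 1) := by
      ring
    rw [hz, hm1, hκ₀, haρ] at h1
    rw [hR, ← hQ, eq_sub_of_add_eq (eq_sub_of_add_eq h1)]
    push_cast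
    field_simp
    ring
  have hRc : ContinuousOn R (Ioi 0) := by
    refine ContinuousOn.div (by fun_prop) (by fun_prop) fun x hx => ?_
    exact (pow_pos hx _).ne'
  have hne : ∀ s ∈ J, p s ≠ ρ₀ := fun s hs h =>
    have hsub : uIcc s 0 ⊆ J := hJ.uIcc_subset hs h0
    hinit.ne' (eq_of_deriv_sq_eq_sub_sq_mul hRc (fun x hx => hdiff x (hsub hx))
      (fun x hx => hpos x (hsub hx)) (fun x hx => hode x (hsub hx)) h)
  refine ⟨fun s hs => ?_, fun s hs h => ?_⟩
  · by_contra! hle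
    have hsub : uIcc s 0 ⊆ J := hJ.uIcc_subset hs h0
    obtain ⟨c, hc, hpc⟩ := intermediate_value_uIcc
      (fun x hx => (hdiff x (hsub hx)).continuousAt.continuousWithinAt)
      (mem_uIcc_of_le hle hinit.le)
    exact hne c (hsub hc) hpc
  · have hx := hpos s hs
    have hQx := hQpos _ hx
    have hRx : 0 < R (p s) := by
      have := neg_pos.mpr hρ
      positivity
    have h1 := hode s hs
    rw [h] at h1
    have := mul_pos (pow_pos (abs_pos.mpr (sub_ne_zero.mpr (hne s hs))) 2) hRx
    rw [sq_abs, ← h1] at this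
    norm_num at this
end

section
/- Let m ≥ 2 be an integer, a < 0, ρ < 0, and set ρ₀ := (a/ρ)^{1/(m+1)} and κ₀ := (m+1)ρρ₀². Let μ < κ₀ and suppose p : ℝ → ℝ is twice differentiable, p > 0, p(0) > ρ₀, and p satisfies both (p')² + ρp² + (2a/(m−1))p^{1−m} = μ/(m−1) and p'' + ρp = a p^{−m} on ℝ. Then p(s) > ρ₀ for all s, there exists τ₀ > 0 with p''(s) ≥ τ₀ for all s, and there exists exactly one s₀ ∈ ℝ with p'(s₀) = 0. -/
/-- A function whose derivative is bounded below by a positive constant has exactly one root. -/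
theorem existsUnique_root_of_le_deriv {f : ℝ → ℝ} (hf : Differentiable ℝ f) {c : ℝ} (hc : 0 < c)
    (h : ∀ x, c ≤ deriv f x) : ∃! x, f x = 0 := by
  have hstrict : StrictMono f := strictMono_of_deriv_pos fun x => hc.trans_le (h x)
  have hmono : Monotone fun x => f x - c * x := by
    refine monotone_of_deriv_nonneg (by fun_prop) fun x => ?_
    have hd : HasDerivAt (fun x => f x - c * x) (deriv f x - c * 1) x :=
      (hf x).hasDerivAt.sub ((hasDerivAt_id x).const_mul c)
    rw [hd.deriv]
    linarith [h x]
  have hr : 0 ≤ |f 0| / c := by positivity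
  have hcr : c * (|f 0| / c) = |f 0| := by field_simp
  have hright := hmono hr
  have hleft := hmono (neg_nonpos.mpr hr)
  simp only [mul_zero, sub_zero, mul_neg, hcr] at hright hleft
  obtain ⟨x, hx⟩ := mem_range_of_exists_le_of_exists_ge (c := 0) hf.continuous
    ⟨-(|f 0| / c), by linarith [le_abs_self (f 0)]⟩
    ⟨|f 0| / c, by linarith [neg_abs_le (f 0)]⟩
  exact ⟨x, hx, fun y hy => hstrict.injective (hy.trans hx.symm)⟩

/-- For `a, ρ < 0` the function `x ↦ a x⁻ᵐ - ρ x` is strictly increasing on the positive reals. -/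
theorem strictMonoOn_mul_zpow_neg_sub_mul (m : ℕ) {a ρ : ℝ} (ha : a < 0) (hρ : ρ < 0) :
    StrictMonoOn (fun x : ℝ => a * x ^ (-(m : ℤ)) - ρ * x) (Set.Ioi 0) := by
  intro x hx y hy hxy
  have hx0 : 0 < x := hx
  have hpow : (y ^ m)⁻¹ ≤ (x ^ m)⁻¹ :=
    inv_anti₀ (pow_pos hx0 m) (pow_le_pow_left₀ hx0.le hxy.le m)
  simp only [zpow_neg, zpow_natCast]
  linarith [mul_le_mul_of_nonpos_left hpow ha.le, mul_lt_mul_of_neg_left hxy hρ]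

/-- A continuous function that starts above `r` and never enters a neighbourhood of `r` stays
above `r` by a uniform margin. -/
theorem exists_forall_add_le_of_forall_not_mem {p : ℝ → ℝ} (hp : Continuous p) {r : ℝ}
    (hinit : r < p 0) {U : Set ℝ} (hU : U ∈ nhds r) (hpU : ∀ s, p s ∉ U) :
    ∃ δ > 0, ∀ s, r + δ ≤ p s := by
  have hgt : ∀ s, r < p s := by
    intro s
    by_contra! hle
    obtain ⟨t, ht⟩ := mem_range_of_exists_le_of_exists_ge hp ⟨s, hle⟩ ⟨0, hinit.le⟩
    exact hpU t (ht ▸ mem_of_mem_nhds hU)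
  obtain ⟨δ, hδ, hball⟩ := Metric.mem_nhds_iff.mp hU
  refine ⟨δ, hδ, fun s => ?_⟩
  by_contra! hlt
  refine hpU s (hball ?_)
  rw [Metric.mem_ball, Real.dist_eq, abs_lt]
  constructor <;> linarith [hgt s]


/-- For `m ≥ 2`, `a < 0`, `ρ < 0`, with `ρ₀ := (a/ρ)^(1/(m+1))`, `κ₀ := (m+1)ρρ₀²`, and
`μ < κ₀`: if `p : ℝ → ℝ` is twice differentiable, positive, `p(0) > ρ₀`, and satisfies
`(p')² + ρ p² + (2a/(m−1)) p^(1−m) = μ/(m−1)` and `p'' + ρ p = a p^(−m)` on `ℝ`, then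
`p > ρ₀` everywhere, `p''` is bounded below by a positive constant, and `p'` has exactly
one root. -/
theorem stmt_7 (m : ℕ) (hm : 2 ≤ m) (a ρ : ℝ) (ha : a < 0) (hρ : ρ < 0)
    (ρ₀ : ℝ) (hρ₀ : ρ₀ = (a / ρ) ^ ((1 : ℝ) / ((m : ℝ) + 1)))
    (κ₀ : ℝ) (hκ₀ : κ₀ = ((m : ℝ) + 1) * ρ * ρ₀ ^ 2)
    (μ : ℝ) (hμ : μ < κ₀)
    (p : ℝ → ℝ)
    (hdiff : ∀ s : ℝ, DifferentiableAt ℝ p s)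
    (hdiff2 : ∀ s : ℝ, DifferentiableAt ℝ (deriv p) s)
    (hpos : ∀ s : ℝ, 0 < p s)
    (hinit : p 0 > ρ₀)
    (hode1 : ∀ s : ℝ,
      (deriv p s) ^ 2 + ρ * (p s) ^ 2 + 2 * a / ((m : ℝ) - 1) * (p s) ^ ((1 : ℤ) - (m : ℤ))
        = μ / ((m : ℝ) - 1))
    (hode2 : ∀ s : ℝ, deriv (deriv p) s + ρ * p s = a * (p s) ^ (-(m : ℤ))) :
    (∀ s : ℝ, ρ₀ < p s) ∧
    (∃ τ₀ : ℝ, 0 < τ₀ ∧ ∀ s : ℝ, τ₀ ≤ deriv (deriv p) s) ∧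
    (∃! s₀ : ℝ, deriv p s₀ = 0) := by
  have hm1 : (0 : ℝ) < (m : ℝ) - 1 := by
    have : (2 : ℝ) ≤ m := by exact_mod_cast hm
    linarith
  have hquot : 0 < a / ρ := div_pos_of_neg_of_neg ha hρ
  have hρ₀pos : 0 < ρ₀ := hρ₀ ▸ Real.rpow_pos_of_pos hquot _
  have hpow : ρ₀ ^ (m + 1) = a / ρ := by
    rw [hρ₀, one_div]
    exact_mod_cast Real.rpow_inv_natCast_pow hquot.le m.succ_ne_zero
  have ha_eq : a = ρ * ρ₀ ^ (m + 1) := by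
    rw [hpow, mul_div_cancel₀ _ hρ.ne]
  have hbalance : a * ρ₀ ^ (-(m : ℤ)) = ρ * ρ₀ := by
    rw [zpow_neg, zpow_natCast, ha_eq]
    field_simp
    ring
  have hcrit : a * ρ₀ ^ ((1 : ℤ) - (m : ℤ)) = ρ * ρ₀ ^ 2 := by
    rw [sub_eq_add_neg, zpow_add₀ hρ₀pos.ne', zpow_one]
    linear_combination ρ₀ * hbalance
  let E : ℝ → ℝ := fun x => ρ * x ^ 2 + 2 * a / ((m : ℝ) - 1) * x ^ ((1 : ℤ) - (m : ℤ))
  have hE : ContinuousAt E ρ₀ :=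
    (continuousAt_const.mul (continuousAt_id.pow 2)).add
      (continuousAt_const.mul (continuousAt_zpow₀ ρ₀ _ (Or.inl hρ₀pos.ne')))
  have hEρ₀ : E ρ₀ = κ₀ / ((m : ℝ) - 1) := by
    simp only [E]
    rw [hκ₀]
    field_simp
    linear_combination 2 * hcrit
  have hU : {x | μ / ((m : ℝ) - 1) < E x} ∈ nhds ρ₀ :=
    hE.eventually (lt_mem_nhds (hEρ₀ ▸ div_lt_div_of_pos_right hμ hm1))
  obtain ⟨δ, hδ, hp⟩ := exists_forall_add_le_of_forall_not_mem
    (Differentiable.continuous hdiff) hinit hU fun s hs => by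
      have hs' : μ / ((m : ℝ) - 1) < E (p s) := hs
      simp only [E] at hs'
      linarith [hode1 s, sq_nonneg (deriv p s)]
  have hmono := strictMonoOn_mul_zpow_neg_sub_mul m ha hρ
  have hδpos : 0 < ρ₀ + δ := by linarith
  let τ₀ : ℝ := a * (ρ₀ + δ) ^ (-(m : ℤ)) - ρ * (ρ₀ + δ)
  have hτ₀ : 0 < τ₀ := by
    have h : a * ρ₀ ^ (-(m : ℤ)) - ρ * ρ₀ < τ₀ := hmono hρ₀pos hδpos (by linarith)
    linarith
  have hbound : ∀ s, τ₀ ≤ deriv (deriv p) s := by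
    intro s
    have h : τ₀ ≤ a * p s ^ (-(m : ℤ)) - ρ * p s := hmono.monotoneOn hδpos (hpos s) (hp s)
    linarith [hode2 s]
  exact ⟨fun s => by linarith [hp s], ⟨τ₀, hτ₀, hbound⟩,
    existsUnique_root_of_le_deriv hdiff2 hτ₀ hbound⟩
end

section
/- Let m ≥ 2 be an integer, a > 0, λ ≤ 0, k ∈ ℝ. Suppose p : ℝ → ℝ is twice differentiable, p > 0, and p satisfies both (p')² + (λ/(m+2))p² + (2a/m)p^{−m} = k and p'' + (λ/(m+2))p = a p^{−m−1} on ℝ. Then there exists p₁ > 0 with p(s) ≥ p₁ for all s, and there exists exactly one s₀ ∈ ℝ with p'(s₀) = 0. -/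
/-- A differentiable function whose derivative satisfies `G (f s) ≤ f'' s` for a positive antitone
`G` on the positive reals cannot be positive and strictly decreasing on all of `ℝ`. -/
theorem exists_deriv_nonneg_of_le_deriv_deriv {f G : ℝ → ℝ} (hf : Differentiable ℝ f)
    (hf' : Differentiable ℝ (deriv f)) (hpos : ∀ s, 0 < f s) (hG : ∀ x, 0 < x → 0 < G x)
    (hanti : AntitoneOn G (Set.Ioi 0)) (hle : ∀ s, G (f s) ≤ deriv (deriv f) s) :
    ∃ s, 0 ≤ deriv f s := by
  by_contra! hneg
  have hε : 0 < G (f 0) := hG _ (hpos 0)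
  have hf_anti : Antitone f := antitone_of_deriv_nonpos hf fun s => (hneg s).le
  set t : ℝ := -deriv f 0 / G (f 0) with ht
  have ht0 : 0 ≤ t := div_nonneg (by linarith [hneg 0]) hε.le
  have hgrow := (convex_Ici (0 : ℝ)).mul_sub_le_image_sub_of_le_deriv hf'.continuous.continuousOn
    hf'.differentiableOn (C := G (f 0)) (fun s hs => by
      rw [interior_Ici] at hs
      exact (hanti (hpos s) (hpos 0) (hf_anti (le_of_lt hs))).trans (hle s))
    0 Set.self_mem_Ici t ht0 ht0
  have hmul : G (f 0) * (t - 0) = -deriv f 0 := by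
    rw [ht]
    field_simp
    ring
  linarith [hneg t]

/-- The reflected form of `exists_deriv_nonneg_of_le_deriv_deriv`. -/
theorem exists_deriv_nonpos_of_le_deriv_deriv {f G : ℝ → ℝ} (hf : Differentiable ℝ f)
    (hf' : Differentiable ℝ (deriv f)) (hpos : ∀ s, 0 < f s) (hG : ∀ x, 0 < x → 0 < G x)
    (hanti : AntitoneOn G (Set.Ioi 0)) (hle : ∀ s, G (f s) ≤ deriv (deriv f) s) :
    ∃ s, deriv f s ≤ 0 := by
  have hderiv : deriv (fun x => f (-x)) = fun x => -deriv f (-x) :=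
    funext fun x => deriv_comp_neg f x
  have hderiv2 (s : ℝ) : deriv (fun x => -deriv f (-x)) s = deriv (deriv f) (-s) := by
    rw [deriv.fun_neg, deriv_comp_neg, neg_neg]
  obtain ⟨s, hs⟩ := exists_deriv_nonneg_of_le_deriv_deriv (f := fun x => f (-x))
    (hf.comp differentiable_neg)
    (by rw [hderiv]; exact (hf'.comp differentiable_neg).neg) (fun s => hpos _) hG hanti
    (fun s => by rw [hderiv, hderiv2]; exact hle (-s))
  rw [hderiv] at hs
  exact ⟨-s, by linarith⟩

/-- A differentiable function with monotone derivative attains its minimum at a critical point. -/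
theorem le_of_monotone_deriv_of_deriv_eq_zero {f : ℝ → ℝ} (hf : Differentiable ℝ f)
    (hmono : Monotone (deriv f)) {c : ℝ} (hc : deriv f c = 0) (s : ℝ) : f c ≤ f s := by
  rcases le_total c s with h | h
  · refine monotoneOn_of_deriv_nonneg (convex_Ici c) hf.continuous.continuousOn
      hf.differentiableOn (fun x hx => ?_) Set.self_mem_Ici h h
    rw [interior_Ici] at hx
    exact hc ▸ hmono (le_of_lt hx)
  · refine antitoneOn_of_deriv_nonpos (convex_Iic c) hf.continuous.continuousOn
      hf.differentiableOn (fun x hx => ?_) h Set.self_mem_Iic h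
    rw [interior_Iic] at hx
    exact hc ▸ hmono (le_of_lt hx)


/-- For `m ≥ 2`, `a > 0`, `λ ≤ 0`, `k ∈ ℝ`: if `p : ℝ → ℝ` is twice differentiable,
positive, and satisfies `(p')² + (λ/(m+2)) p² + (2a/m) p^(−m) = k` and
`p'' + (λ/(m+2)) p = a p^(−m−1)` on `ℝ`, then `p` is bounded below by a positive
constant and `p'` has exactly one root. -/
theorem stmt_8 (m : ℕ) (hm : 2 ≤ m) (a lam k : ℝ) (ha : 0 < a) (hlam : lam ≤ 0)
    (p : ℝ → ℝ)
    (hdiff : ∀ s : ℝ, DifferentiableAt ℝ p s)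
    (hdiff2 : ∀ s : ℝ, DifferentiableAt ℝ (deriv p) s)
    (hpos : ∀ s : ℝ, 0 < p s)
    (hode1 : ∀ s : ℝ,
      (deriv p s) ^ 2 + lam / ((m : ℝ) + 2) * (p s) ^ 2 + 2 * a / (m : ℝ) * (p s) ^ (-(m : ℤ))
        = k)
    (hode2 : ∀ s : ℝ,
      deriv (deriv p) s + lam / ((m : ℝ) + 2) * p s = a * (p s) ^ (-(m : ℤ) - 1)) :
    (∃ p₁ : ℝ, 0 < p₁ ∧ ∀ s : ℝ, p₁ ≤ p s) ∧ (∃! s₀ : ℝ, deriv p s₀ = 0) := by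
  have hle (s : ℝ) : a * (p s) ^ (-(m : ℤ) - 1) ≤ deriv (deriv p) s := by
    have hcoef : lam / ((m : ℝ) + 2) ≤ 0 := div_nonpos_of_nonpos_of_nonneg hlam (by positivity)
    linarith [hode2 s, mul_nonpos_of_nonpos_of_nonneg hcoef (hpos s).le]
  have hG (x : ℝ) (hx : 0 < x) : 0 < a * x ^ (-(m : ℤ) - 1) := mul_pos ha (zpow_pos hx _)
  have hanti : AntitoneOn (fun x : ℝ => a * x ^ (-(m : ℤ) - 1)) (Set.Ioi 0) := by
    intro x hx y hy hxy
    have hexp : -(m : ℤ) - 1 = -((m + 1 : ℕ) : ℤ) := by push_cast; ring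
    simp only [hexp, zpow_neg, zpow_natCast]
    have hx' : 0 < x := hx
    gcongr
  have hmono : StrictMono (deriv p) :=
    strictMono_of_deriv_pos fun s => (hG _ (hpos s)).trans_le (hle s)
  obtain ⟨u, hu⟩ := exists_deriv_nonpos_of_le_deriv_deriv hdiff hdiff2 hpos hG hanti hle
  obtain ⟨v, hv⟩ := exists_deriv_nonneg_of_le_deriv_deriv hdiff hdiff2 hpos hG hanti hle
  have hcont : Continuous (deriv p) := Differentiable.continuous hdiff2
  obtain ⟨c, hc⟩ := mem_range_of_exists_le_of_exists_ge hcont ⟨u, hu⟩ ⟨v, hv⟩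
  exact ⟨⟨p c, hpos c, le_of_monotone_deriv_of_deriv_eq_zero hdiff hmono.monotone hc⟩,
    c, hc, fun y hy => hmono.injective (hy.trans hc.symm)⟩
end

section
/- Let m ≥ 2 be an integer, a < 0, λ < 0, and set ρ₀ := (a(m+2)/λ)^{1/(m+2)} and κ₀ := (λ/m)ρ₀². Let J ⊆ ℝ be an interval containing 0 and suppose p : J → ℝ is twice differentiable, p > 0, p(0) > ρ₀, and p satisfies both (p')² + (λ/(m+2))p² + (2a/m)p^{−m} = κ₀ and p'' + (λ/(m+2))p = a p^{−m−1} on J. Then p(s) > ρ₀ for all s ∈ J and p'(s) ≠ 0 for all s ∈ J. -/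
/-- A function that starts positive and decays at most exponentially while positive
stays positive. -/
theorem pos_of_neg_deriv_le_mul {f f' : ℝ → ℝ} {L b : ℝ} (hb : 0 ≤ b)
    (hf : ∀ s ∈ Set.Icc 0 b, HasDerivAt f (f' s) s)
    (hf' : ∀ s ∈ Set.Icc 0 b, 0 < f s → -f' s ≤ L * f s) (h0 : 0 < f 0) : 0 < f b := by
  have key := image_le_of_deriv_right_lt_deriv_boundary (f := fun s => -f s)
    (f' := fun s => -f' s) (a := 0) (b := b)
    (B := fun s => -(f 0 * Real.exp (-((L + 1) * s))))
    (B' := fun s => (L + 1) * (f 0 * Real.exp (-((L + 1) * s))))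
    (fun s hs => (hf s hs).continuousAt.neg.continuousWithinAt)
    (fun s hs => (hf s (Set.Ico_subset_Icc_self hs)).neg.hasDerivWithinAt)
    (by simp)
    (fun s => by
      have h1 : HasDerivAt (fun s : ℝ => -((L + 1) * s)) (-((L + 1) * 1)) s :=
        ((hasDerivAt_id s).const_mul (L + 1)).neg
      exact (h1.exp.const_mul (f 0)).neg.congr_deriv (by ring))
    (fun s hs h => by
      have he : f s = f 0 * Real.exp (-((L + 1) * s)) := neg_injective h
      have hp : 0 < f s := he ▸ mul_pos h0 (Real.exp_pos _)
      have := hf' s (Set.Ico_subset_Icc_self hs) hp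
      change -f' s < (L + 1) * (f 0 * Real.exp (-((L + 1) * s)))
      rw [← he]
      linarith)
    (Set.right_mem_Icc.2 hb)
  have : 0 < f 0 * Real.exp (-((L + 1) * b)) := mul_pos h0 (Real.exp_pos _)
  simp only [neg_le_neg_iff] at key
  exact this.trans_le key

/-- Second-order Taylor upper bound for `(1 + d)⁻ᵐ`. -/
theorem inv_one_add_pow_le {d : ℝ} (hd : 0 ≤ d) (m : ℕ) :
    ((1 + d) ^ m)⁻¹ ≤ 1 - m * d + m * (m + 1) / 2 * d ^ 2 := by
  have hd1 : 0 < 1 + d := by linarith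
  induction m with
  | zero => simp
  | succ n ih =>
    rw [pow_succ, mul_inv, ← div_eq_mul_inv, div_le_iff₀ hd1]
    refine ih.trans ?_
    have h : (0 : ℝ) ≤ ((n : ℝ) + 1) * (n + 2) / 2 * d ^ 3 := by positivity
    push_cast
    nlinarith

/-- The potential in normalised form, bounded above by a quadratic. -/
theorem potential_le {t : ℝ} (ht : 1 ≤ t) (m : ℕ) :
    m * t ^ 2 + 2 * (t ^ m)⁻¹ - (m + 2) ≤ m * (m + 2) * (t - 1) ^ 2 := by
  have h := inv_one_add_pow_le (sub_nonneg.2 ht) m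
  rw [add_sub_cancel] at h
  nlinarith

/-- The potential in normalised form is positive to the right of its zero. -/
theorem potential_pos {t : ℝ} (ht : 1 < t) {m : ℕ} (hm : 0 < m) :
    0 < m * t ^ 2 + 2 * (t ^ m)⁻¹ - ((m : ℝ) + 2) := by
  have ht0 : 0 < t := by linarith
  have hti : 0 < t⁻¹ := inv_pos.2 ht0
  have h := one_add_mul_le_pow (a := t⁻¹ - 1) (by linarith) m
  rw [add_sub_cancel, inv_pow] at h
  have hm' : (0 : ℝ) < m := by exact_mod_cast hm
  have h2 : 0 < t ^ 2 + 2 * t⁻¹ - 3 := by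
    have : t ^ 2 + 2 * t⁻¹ - 3 = (t - 1) ^ 2 * (t + 2) * t⁻¹ := by
      field_simp
      ring
    rw [this]
    have : 0 < t - 1 := by linarith
    positivity
  nlinarith [mul_pos hm' h2]

/-- The potential `κ₀ - λ/(m+2) x² - (2a/m) x⁻ᵐ` in terms of the normalised variable `x / ρ`. -/
theorem potential_eq {m : ℕ} (hm : 0 < m) {a lam ρ x : ℝ} (hρ : 0 < ρ) (hx : 0 < x)
    (h : lam * ρ ^ (m + 2) = a * (m + 2)) :
    lam / m * ρ ^ 2 - lam / (m + 2) * x ^ 2 - 2 * a / m * x ^ (-(m : ℤ)) =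
      -lam * ρ ^ 2 / (m * (m + 2)) *
        (m * (x / ρ) ^ 2 + 2 * ((x / ρ) ^ m)⁻¹ - (m + 2)) := by
  have hm' : (0 : ℝ) < m := by exact_mod_cast hm
  have ha : a = lam * ρ ^ (m + 2) / (m + 2) := by
    rw [h]
    field_simp
  rw [ha, zpow_neg, zpow_natCast, div_pow, div_pow]
  field_simp
  ring


/-- For `m ≥ 2`, `a < 0`, `λ < 0`, with `ρ₀ := (a(m+2)/λ)^(1/(m+2))` and `κ₀ := (λ/m)ρ₀²`:
if `J` is an interval containing `0`, `p` is twice differentiable, positive, `p(0) > ρ₀`,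
and satisfies `(p')² + (λ/(m+2)) p² + (2a/m) p^(−m) = κ₀` and
`p'' + (λ/(m+2)) p = a p^(−m−1)` on `J`, then `p > ρ₀` and `p' ≠ 0` on `J`. -/
theorem stmt_9 (m : ℕ) (hm : 2 ≤ m) (a lam : ℝ) (ha : a < 0) (hlam : lam < 0)
    (ρ₀ : ℝ) (hρ₀ : ρ₀ = (a * ((m : ℝ) + 2) / lam) ^ ((1 : ℝ) / ((m : ℝ) + 2)))
    (κ₀ : ℝ) (hκ₀ : κ₀ = lam / (m : ℝ) * ρ₀ ^ 2)
    (J : Set ℝ) (hJ : J.OrdConnected) (h0 : (0 : ℝ) ∈ J)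
    (p : ℝ → ℝ)
    (hdiff : ∀ s ∈ J, DifferentiableAt ℝ p s)
    (hdiff2 : ∀ s ∈ J, DifferentiableAt ℝ (deriv p) s)
    (hpos : ∀ s ∈ J, 0 < p s)
    (hinit : p 0 > ρ₀)
    (hode1 : ∀ s ∈ J,
      (deriv p s) ^ 2 + lam / ((m : ℝ) + 2) * (p s) ^ 2 + 2 * a / (m : ℝ) * (p s) ^ (-(m : ℤ))
        = κ₀)
    (hode2 : ∀ s ∈ J,
      deriv (deriv p) s + lam / ((m : ℝ) + 2) * p s = a * (p s) ^ (-(m : ℤ) - 1)) :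
    (∀ s ∈ J, ρ₀ < p s) ∧ (∀ s ∈ J, deriv p s ≠ 0) := by
  have hm0 : 0 < m := by omega
  have hm' : (0 : ℝ) < m := by exact_mod_cast hm0
  have hq : 0 < a * ((m : ℝ) + 2) / lam :=
    div_pos_of_neg_of_neg (mul_neg_of_neg_of_pos ha (by positivity)) hlam
  have hρ : 0 < ρ₀ := hρ₀ ▸ Real.rpow_pos_of_pos hq _
  have hpow : lam * ρ₀ ^ (m + 2) = a * (m + 2) := by
    have : ρ₀ ^ (m + 2) = a * ((m : ℝ) + 2) / lam := by
      rw [hρ₀, ← Real.rpow_natCast, ← Real.rpow_mul hq.le]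
      push_cast
      rw [one_div_mul_cancel (by positivity), Real.rpow_one]
    rw [this, mul_div_cancel₀ _ hlam.ne]
  have hsq : ∀ s ∈ J, deriv p s ^ 2 = -lam * ρ₀ ^ 2 / (m * (m + 2)) *
      (m * (p s / ρ₀) ^ 2 + 2 * ((p s / ρ₀) ^ m)⁻¹ - (m + 2)) := fun s hs => by
    rw [← potential_eq hm0 hρ (hpos s hs) hpow, ← hκ₀, ← hode1 s hs]
    ring
  have hL : 0 < 1 - lam := by linarith
  have hbound : ∀ s ∈ J, 0 < p s - ρ₀ → |deriv p s| ≤ (1 - lam) * (p s - ρ₀) := by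
    intro s hs h
    refine abs_le_of_sq_le_sq ?_ (by positivity)
    have hc : 0 ≤ -lam * ρ₀ ^ 2 / (m * (m + 2)) := by
      have : 0 < -lam := by linarith
      positivity
    calc deriv p s ^ 2
        ≤ -lam * ρ₀ ^ 2 / (m * (m + 2)) * (m * (m + 2) * (p s / ρ₀ - 1) ^ 2) := by
          rw [hsq s hs]
          exact mul_le_mul_of_nonneg_left
            (potential_le ((one_le_div hρ).2 (by linarith)) m) hc
      _ = -lam * (p s - ρ₀) ^ 2 := by
          field_simp
      _ ≤ (1 - lam) ^ 2 * (p s - ρ₀) ^ 2 :=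
          mul_le_mul_of_nonneg_right (by nlinarith) (sq_nonneg _)
      _ = ((1 - lam) * (p s - ρ₀)) ^ 2 := by ring
  have hgt : ∀ s ∈ J, ρ₀ < p s := by
    intro s hs
    rcases le_total 0 s with h | h
    · have hsub : Set.Icc 0 s ⊆ J := hJ.out h0 hs
      exact sub_pos.1 <| pos_of_neg_deriv_le_mul (f := fun x => p x - ρ₀) h
        (fun x hx => (hdiff x (hsub hx)).hasDerivAt.sub_const ρ₀)
        (fun x hx hp => (neg_le_abs _).trans (hbound x (hsub hx) hp))
        (sub_pos.2 hinit)
    · have hsub : ∀ x ∈ Set.Icc 0 (-s), -x ∈ J := fun x hx =>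
        hJ.out hs h0 ⟨by linarith [hx.2], by linarith [hx.1]⟩
      have key := pos_of_neg_deriv_le_mul (f := fun x => p (-x) - ρ₀)
        (f' := fun x => -deriv p (-x)) (neg_nonneg.2 h)
        (fun x hx => by
          have h1 := (hdiff _ (hsub x hx)).hasDerivAt.comp x (hasDerivAt_neg x)
          rw [mul_neg_one] at h1
          exact h1.sub_const ρ₀)
        (fun x hx hp => by
          rw [neg_neg]
          exact (le_abs_self _).trans (hbound _ (hsub x hx) hp))
        (by simpa using hinit)
      simpa using key
  refine ⟨hgt, fun s hs h => ?_⟩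
  have hpp := potential_pos ((one_lt_div hρ).2 (hgt s hs)) hm0
  have hc : 0 < -lam * ρ₀ ^ 2 / (m * ((m : ℝ) + 2)) := by
    have : 0 < -lam := by linarith
    positivity
  have := hsq s hs
  rw [h] at this
  have h3 := mul_pos hc hpp
  linarith
end

section
/- Let m ≥ 2 be an integer, a < 0, λ < 0, and set ρ₀ := (a(m+2)/λ)^{1/(m+2)} and κ₀ := (λ/m)ρ₀². Let k < κ₀ and suppose p : ℝ → ℝ is twice differentiable, p > 0, p(0) > ρ₀, and p satisfies both (p')² + (λ/(m+2))p² + (2a/m)p^{−m} = k and p'' + (λ/(m+2))p = a p^{−m−1} on ℝ. Then p(s) > ρ₀ for all s, there exists τ₀ > 0 with p''(s) ≥ τ₀ for all s, and there exists exactly one s₀ ∈ ℝ with p'(s₀) = 0. -/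
/-- A differentiable real function whose derivative is bounded below by a positive constant
has exactly one zero. -/
theorem existsUnique_eq_zero_of_le_deriv {f : ℝ → ℝ} (hf : Differentiable ℝ f) {τ : ℝ}
    (hτ : 0 < τ) (hle : ∀ x, τ ≤ deriv f x) : ∃! x, f x = 0 := by
  have hmono : StrictMono f := strictMono_of_deriv_pos fun x => hτ.trans_le (hle x)
  have hM : 0 ≤ |f 0| / τ := by positivity
  have hτM : τ * (|f 0| / τ) = |f 0| := by field_simp
  have hup := mul_sub_le_image_sub_of_le_deriv hf hle hM
  have hdown := mul_sub_le_image_sub_of_le_deriv hf hle (neg_nonpos.2 hM)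
  obtain ⟨x, hx⟩ : 0 ∈ Set.range f :=
    mem_range_of_exists_le_of_exists_ge hf.continuous
      ⟨-(|f 0| / τ), by linarith [le_abs_self (f 0)]⟩
      ⟨|f 0| / τ, by linarith [neg_abs_le (f 0)]⟩
  exact ⟨x, hx, fun y hy => hmono.injective (hy.trans hx.symm)⟩


/-- For `m ≥ 2`, `a < 0`, `λ < 0`, with `ρ₀ := (a(m+2)/λ)^(1/(m+2))`, `κ₀ := (λ/m)ρ₀²`, and
`k < κ₀`: if `p : ℝ → ℝ` is twice differentiable, positive, `p(0) > ρ₀`, and satisfies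
`(p')² + (λ/(m+2)) p² + (2a/m) p^(−m) = k` and `p'' + (λ/(m+2)) p = a p^(−m−1)` on `ℝ`,
then `p > ρ₀` everywhere, `p''` is bounded below by a positive constant, and `p'` has
exactly one root. -/
theorem stmt_10 (m : ℕ) (hm : 2 ≤ m) (a lam : ℝ) (ha : a < 0) (hlam : lam < 0)
    (ρ₀ : ℝ) (hρ₀ : ρ₀ = (a * ((m : ℝ) + 2) / lam) ^ ((1 : ℝ) / ((m : ℝ) + 2)))
    (κ₀ : ℝ) (hκ₀ : κ₀ = lam / (m : ℝ) * ρ₀ ^ 2)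
    (k : ℝ) (hk : k < κ₀)
    (p : ℝ → ℝ)
    (hdiff : ∀ s : ℝ, DifferentiableAt ℝ p s)
    (hdiff2 : ∀ s : ℝ, DifferentiableAt ℝ (deriv p) s)
    (hpos : ∀ s : ℝ, 0 < p s)
    (hinit : p 0 > ρ₀)
    (hode1 : ∀ s : ℝ,
      (deriv p s) ^ 2 + lam / ((m : ℝ) + 2) * (p s) ^ 2 + 2 * a / (m : ℝ) * (p s) ^ (-(m : ℤ))
        = k)
    (hode2 : ∀ s : ℝ,
      deriv (deriv p) s + lam / ((m : ℝ) + 2) * p s = a * (p s) ^ (-(m : ℤ) - 1)) :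
    (∀ s : ℝ, ρ₀ < p s) ∧
    (∃ τ₀ : ℝ, 0 < τ₀ ∧ ∀ s : ℝ, τ₀ ≤ deriv (deriv p) s) ∧
    (∃! s₀ : ℝ, deriv p s₀ = 0) := by
  have hm2 : (0 : ℝ) < (m : ℝ) + 2 := by positivity
  have hm0 : (m : ℝ) ≠ 0 := by positivity
  set c := lam / ((m : ℝ) + 2) with hc
  have hc0 : c < 0 := div_neg_of_neg_of_pos hlam hm2
  have hlamc : lam = c * ((m : ℝ) + 2) := by rw [hc]; field_simp
  have hquot : a * ((m : ℝ) + 2) / lam = a / c := by rw [hc]; field_simp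
  have hquot_pos : 0 < a / c := div_pos_of_neg_of_neg ha hc0
  have hρ_pos : 0 < ρ₀ := by rw [hρ₀, hquot]; positivity
  have hρ_pow : ρ₀ ^ (m + 2) = a / c := by
    have h := Real.rpow_inv_natCast_pow hquot_pos.le (n := m + 2) (by omega)
    push_cast at h
    rw [hρ₀, hquot, one_div, h]
  have hac : a = c * ρ₀ ^ (m + 2) := by rw [hρ_pow, mul_div_cancel₀ _ hc0.ne]
  have hzpow : ∀ x : ℝ, x ^ (-(m : ℤ) - 1) = (x ^ (m + 1))⁻¹ := fun x => by
    rw [← zpow_natCast, ← zpow_neg]; congr 1; push_cast; ring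
  have hρ_force : a * (ρ₀ ^ (m + 1))⁻¹ = c * ρ₀ := by rw [hac]; field_simp; ring
  have hρ_energy : c * ρ₀ ^ 2 + 2 * a / (m : ℝ) * ρ₀ ^ (-(m : ℤ)) = κ₀ := by
    rw [hκ₀, hlamc, hac, zpow_neg, zpow_natCast]; field_simp; ring
  have hcont : ContinuousAt (fun x : ℝ => c * x ^ 2 + 2 * a / (m : ℝ) * x ^ (-(m : ℤ))) ρ₀ :=
    (continuousAt_const.mul (continuousAt_id.pow 2)).add
      (continuousAt_const.mul (continuousAt_zpow₀ _ _ (Or.inl hρ_pos.ne')))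
  obtain ⟨δ, hδ, hball⟩ := Metric.eventually_nhds_iff.1
    (hcont.eventually (lt_mem_nhds (hρ_energy.symm ▸ hk)))
  have havoid : ∀ s, δ ≤ |p s - ρ₀| := fun s => by
    by_contra! h
    have := hball (y := p s) (by rwa [Real.dist_eq])
    linarith [hode1 s, sq_nonneg (deriv p s)]
  have hgt : ∀ s, ρ₀ < p s := fun s => by
    by_contra! h
    obtain ⟨t, ht⟩ := mem_range_of_exists_le_of_exists_ge
      (Differentiable.continuous hdiff) ⟨s, h⟩ ⟨0, hinit.le⟩
    have := havoid t
    rw [ht, sub_self, abs_zero] at this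
    linarith
  have hτ : 0 < -c * δ := mul_pos (neg_pos.2 hc0) hδ
  have hconvex : ∀ s, -c * δ ≤ deriv (deriv p) s := fun s => by
    have hfar : δ ≤ p s - ρ₀ := by
      simpa [abs_of_pos (sub_pos.2 (hgt s))] using havoid s
    have hinv : (p s ^ (m + 1))⁻¹ ≤ (ρ₀ ^ (m + 1))⁻¹ := by
      gcongr
      exact (hgt s).le
    have hode := hode2 s
    rw [hzpow] at hode
    linarith [mul_le_mul_of_nonpos_left hinv ha.le,
      mul_le_mul_of_nonneg_left hfar (neg_pos.2 hc0).le]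
  exact ⟨hgt, ⟨_, hτ, hconvex⟩, existsUnique_eq_zero_of_le_deriv hdiff2 hτ hconvex⟩
end

section
/- Let m ≥ 2 be an integer and λ ∈ ℝ. Let J ⊆ ℝ be an open interval and p : J → ℝ three times differentiable with p > 0 on J, satisfying p·p''' + (m+1)·p'·p'' + λ·p·p' = 0 on J. Then: (i) the function m(p')² + 2pp'' + λp² is constant on J; (ii) if its constant value is k·m for a real number k, then the function p^m·((p')² + (λ/(m+2))p² − k) is constant on J; in particular, writing −2a/m for this constant value, p satisfies (p')² + (λ/(m+2))p² + (2a/m)p^{−m} = k on J. -/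
/-- A function whose derivative vanishes on an open interval is constant there. -/
theorem exists_eq_const_of_hasDerivAt_zero {α β : ℝ} {f : ℝ → ℝ}
    (hf : ∀ s ∈ Set.Ioo α β, HasDerivAt f 0 s) : ∃ c, ∀ s ∈ Set.Ioo α β, f s = c :=
  isOpen_Ioo.exists_is_const_of_deriv_eq_zero isPreconnected_Ioo
    (fun s hs => (hf s hs).differentiableAt.differentiableWithinAt)
    (fun s hs => (hf s hs).deriv)

/-- For `m ≥ 2` and `λ ∈ ℝ`: if `p > 0` is three times differentiable on an open interval
`J = (α, β)` and satisfies `p p''' + (m+1) p' p'' + λ p p' = 0` on `J`, then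
(i) `m (p')² + 2 p p'' + λ p²` is constant on `J`; and
(ii) if its constant value is `k·m`, then `p^m ((p')² + (λ/(m+2)) p² − k)` is constant on
`J`, and, writing `−2a/m` for this constant value, `p` satisfies
`(p')² + (λ/(m+2)) p² + (2a/m) p^(−m) = k` on `J`. -/
theorem stmt_11 (m : ℕ) (hm : 2 ≤ m) (lam α β : ℝ)
    (p : ℝ → ℝ)
    (hdiff : ∀ s ∈ Set.Ioo α β, DifferentiableAt ℝ p s)
    (hdiff2 : ∀ s ∈ Set.Ioo α β, DifferentiableAt ℝ (deriv p) s)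
    (hdiff3 : ∀ s ∈ Set.Ioo α β, DifferentiableAt ℝ (deriv (deriv p)) s)
    (hpos : ∀ s ∈ Set.Ioo α β, 0 < p s)
    (hode : ∀ s ∈ Set.Ioo α β,
      p s * deriv (deriv (deriv p)) s + ((m : ℝ) + 1) * deriv p s * deriv (deriv p) s
        + lam * p s * deriv p s = 0) :
    (∃ c : ℝ, ∀ s ∈ Set.Ioo α β,
        (m : ℝ) * (deriv p s) ^ 2 + 2 * p s * deriv (deriv p) s + lam * (p s) ^ 2 = c) ∧
    (∀ k : ℝ,
      (∀ s ∈ Set.Ioo α β,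
          (m : ℝ) * (deriv p s) ^ 2 + 2 * p s * deriv (deriv p) s + lam * (p s) ^ 2
            = k * (m : ℝ)) →
      ∃ a : ℝ,
        (∀ s ∈ Set.Ioo α β,
          (p s) ^ m * ((deriv p s) ^ 2 + lam / ((m : ℝ) + 2) * (p s) ^ 2 - k)
            = -(2 * a) / (m : ℝ)) ∧
        (∀ s ∈ Set.Ioo α β,
          (deriv p s) ^ 2 + lam / ((m : ℝ) + 2) * (p s) ^ 2
            + 2 * a / (m : ℝ) * (p s) ^ (-(m : ℤ)) = k)) := by
  have hm0 : (m : ℝ) ≠ 0 := by positivity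
  have hm2 : (m : ℝ) + 2 ≠ 0 := by positivity
  refine ⟨exists_eq_const_of_hasDerivAt_zero fun s hs => ?_, fun k hk => ?_⟩
  · have h0 := (hdiff s hs).hasDerivAt
    have h1 := (hdiff2 s hs).hasDerivAt
    have h2 := (hdiff3 s hs).hasDerivAt
    refine ((((h1.fun_pow 2).const_mul (m : ℝ)).fun_add ((h0.const_mul 2).fun_mul h2)).fun_add
      ((h0.fun_pow 2).const_mul lam)).congr_deriv ?_
    push_cast
    linear_combination 2 * hode s hs
  · obtain ⟨c, hc⟩ := exists_eq_const_of_hasDerivAt_zero (α := α) (β := β)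
      (f := fun s => (p s) ^ m * ((deriv p s) ^ 2 + lam / ((m : ℝ) + 2) * (p s) ^ 2 - k))
      fun s hs => by
        have h0 := (hdiff s hs).hasDerivAt
        have h1 := (hdiff2 s hs).hasDerivAt
        refine ((h0.fun_pow m).fun_mul (((h1.fun_pow 2).fun_add
          ((h0.fun_pow 2).const_mul (lam / ((m : ℝ) + 2)))).sub_const k)).congr_deriv ?_
        have hpow : p s ^ m = p s ^ (m - 1) * p s := (pow_sub_one_mul (by lia) _).symm
        have hlam : lam / ((m : ℝ) + 2) * ((m : ℝ) + 2) = lam := div_mul_cancel₀ _ hm2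
        rw [hpow]
        push_cast
        linear_combination p s ^ (m - 1) * deriv p s * hk s hs
          + p s ^ (m - 1) * deriv p s * p s ^ 2 * hlam
    refine ⟨-(m * c) / 2, fun s hs => ?_, fun s hs => ?_⟩
    · rw [hc s hs]
      field_simp
    · have hps : p s ^ m ≠ 0 := (pow_pos (hpos s hs) m).ne'
      rw [← hc s hs, zpow_neg, zpow_natCast]
      field_simp
      ring
end

section
/- Let m ≥ 2 be an integer and ρ ∈ ℝ. Let J ⊆ ℝ be an open interval and p : J → ℝ three times differentiable with p > 0 on J, satisfying p·p''' + m·p'·p'' + (m+1)·ρ·p·p' = 0 on J. Then: (i) the function (m+1)ρp² + 2pp'' + (m−1)(p')² is constant on J; (ii) if its constant value is μ ∈ ℝ, then the function p^{m−1}·((p')² + ρp² − μ/(m−1)) is constant on J; in particular, writing 2a/(m−1) for the negative of ... namely denoting the constant value by −2a/(m−1), p satisfies (p')² + ρp² + (2a/(m−1))p^{1−m} = μ/(m−1) on J. -/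
/-- A real function with vanishing derivative on an open interval is constant there. -/
theorem exists_const_of_hasDerivAt_zero_Ioo {f : ℝ → ℝ} {α β : ℝ}
    (hf : ∀ s ∈ Set.Ioo α β, HasDerivAt f 0 s) : ∃ c, ∀ s ∈ Set.Ioo α β, f s = c :=
  isOpen_Ioo.exists_is_const_of_deriv_eq_zero isPreconnected_Ioo
    (fun s hs => (hf s hs).differentiableAt.differentiableWithinAt)
    (fun s hs => (hf s hs).deriv)


/-- For `m ≥ 2` and `ρ ∈ ℝ`: if `p > 0` is three times differentiable on an open interval
`J = (α, β)` and satisfies `p p''' + m p' p'' + (m+1) ρ p p' = 0` on `J`, then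
(i) `(m+1) ρ p² + 2 p p'' + (m−1)(p')²` is constant on `J`; and
(ii) if its constant value is `μ`, then `p^(m−1) ((p')² + ρ p² − μ/(m−1))` is constant
on `J`, and, denoting this constant value by `−2a/(m−1)`, `p` satisfies
`(p')² + ρ p² + (2a/(m−1)) p^(1−m) = μ/(m−1)` on `J`. -/
theorem stmt_12 (m : ℕ) (hm : 2 ≤ m) (ρ α β : ℝ)
    (p : ℝ → ℝ)
    (hdiff : ∀ s ∈ Set.Ioo α β, DifferentiableAt ℝ p s)
    (hdiff2 : ∀ s ∈ Set.Ioo α β, DifferentiableAt ℝ (deriv p) s)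
    (hdiff3 : ∀ s ∈ Set.Ioo α β, DifferentiableAt ℝ (deriv (deriv p)) s)
    (hpos : ∀ s ∈ Set.Ioo α β, 0 < p s)
    (hode : ∀ s ∈ Set.Ioo α β,
      p s * deriv (deriv (deriv p)) s + (m : ℝ) * deriv p s * deriv (deriv p) s
        + ((m : ℝ) + 1) * ρ * p s * deriv p s = 0) :
    (∃ c : ℝ, ∀ s ∈ Set.Ioo α β,
        ((m : ℝ) + 1) * ρ * (p s) ^ 2 + 2 * p s * deriv (deriv p) s
          + ((m : ℝ) - 1) * (deriv p s) ^ 2 = c) ∧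
    (∀ μ : ℝ,
      (∀ s ∈ Set.Ioo α β,
          ((m : ℝ) + 1) * ρ * (p s) ^ 2 + 2 * p s * deriv (deriv p) s
            + ((m : ℝ) - 1) * (deriv p s) ^ 2 = μ) →
      ∃ a : ℝ,
        (∀ s ∈ Set.Ioo α β,
          (p s) ^ (m - 1) * ((deriv p s) ^ 2 + ρ * (p s) ^ 2 - μ / ((m : ℝ) - 1))
            = -(2 * a) / ((m : ℝ) - 1)) ∧
        (∀ s ∈ Set.Ioo α β,
          (deriv p s) ^ 2 + ρ * (p s) ^ 2
            + 2 * a / ((m : ℝ) - 1) * (p s) ^ ((1 : ℤ) - (m : ℤ)) = μ / ((m : ℝ) - 1))) := by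
  obtain ⟨n, rfl⟩ : ∃ n, m = n + 2 := ⟨m - 2, by omega⟩
  have hn : ((n + 2 : ℕ) : ℝ) - 1 = (n : ℝ) + 1 := by push_cast; ring
  have hn0 : (n : ℝ) + 1 ≠ 0 := by positivity
  refine ⟨exists_const_of_hasDerivAt_zero_Ioo fun s hs => ?_, fun μ hμ => ?_⟩
  · have h1 := (hdiff s hs).hasDerivAt
    have h2 := (hdiff2 s hs).hasDerivAt
    have h3 := (hdiff3 s hs).hasDerivAt
    refine HasDerivAt.congr_deriv ((((h1.fun_pow 2).const_mul ((((n + 2 : ℕ) : ℝ) + 1) * ρ)).fun_add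
      ((h1.const_mul 2).fun_mul h3)).fun_add
      ((h2.fun_pow 2).const_mul (((n + 2 : ℕ) : ℝ) - 1))) ?_
    push_cast
    have h := hode s hs
    push_cast at h
    linear_combination 2 * h
  · obtain ⟨c, hc⟩ : ∃ c, ∀ s ∈ Set.Ioo α β,
        p s ^ (n + 1) * (deriv p s ^ 2 + ρ * p s ^ 2 - μ / ((n : ℝ) + 1)) = c := by
      refine exists_const_of_hasDerivAt_zero_Ioo fun s hs => ?_
      have h1 := (hdiff s hs).hasDerivAt
      have h2 := (hdiff2 s hs).hasDerivAt
      refine HasDerivAt.congr_deriv ((h1.fun_pow (n + 1)).fun_mul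
        (((h2.fun_pow 2).fun_add ((h1.fun_pow 2).const_mul ρ)).sub_const (μ / ((n : ℝ) + 1)))) ?_
      have h := hμ s hs
      have hdiv : ((n : ℝ) + 1) * (μ / ((n : ℝ) + 1)) = μ := mul_div_cancel₀ _ hn0
      simp only [Nat.add_sub_cancel]
      push_cast at h ⊢
      linear_combination (p s ^ n * deriv p s) * h - (p s ^ n * deriv p s) * hdiv
    refine ⟨-(c * ((n : ℝ) + 1)) / 2, fun s hs => ?_, fun s hs => ?_⟩
    · rw [hn, show n + 2 - 1 = n + 1 from rfl, hc s hs]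
      field_simp
    · have hp := (pow_pos (hpos s hs) (n + 1)).ne'
      have hz : p s ^ ((1 : ℤ) - ((n + 2 : ℕ) : ℤ)) = (p s ^ (n + 1))⁻¹ := by
        rw [← zpow_natCast, ← zpow_neg]
        congr 1
      rw [hn, hz, ← hc s hs]
      field_simp
      ring
end

section
/- Let m ≥ 2 be an integer and λ ∈ ℝ. Let J ⊆ ℝ be an open interval, p : J → ℝ three times differentiable with p > 0 and p' nowhere zero on J, and w : J → ℝ twice differentiable with w > 0 and w' not identically zero on J. Suppose that on J: (p'/p)·w' = (w/m)·(−2p''/p − λ), (p''/p')·w' = w'', and w'' = (w/m)·(−p''/p − p'''/p' − λ). Then there exists a constant c₁ > 0 with w = c₁·p on J, and there exists a constant a ∈ ℝ such that (p')² + (λ/(m+2))p² + (2a/m)p^{−m} = 0 on J. -/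
/-- For `m ≥ 2` and `λ ∈ ℝ`: on an open interval `J = (α, β)`, let `p > 0` be three times
differentiable with `p'` nowhere zero and `w > 0` twice differentiable with `w'` not
identically zero, satisfying `(p'/p) w' = (w/m)(−2p''/p − λ)`, `(p''/p') w' = w''`, and
`w'' = (w/m)(−p''/p − p'''/p' − λ)` on `J`. Then `w = c₁ p` on `J` for some constant
`c₁ > 0`, and `(p')² + (λ/(m+2)) p² + (2a/m) p^(−m) = 0` on `J` for some constant `a`. -/
theorem stmt_15 (m : ℕ) (hm : 2 ≤ m) (lam α β : ℝ)
    (p w : ℝ → ℝ)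
    (hpdiff : ∀ s ∈ Set.Ioo α β, DifferentiableAt ℝ p s)
    (hpdiff2 : ∀ s ∈ Set.Ioo α β, DifferentiableAt ℝ (deriv p) s)
    (hpdiff3 : ∀ s ∈ Set.Ioo α β, DifferentiableAt ℝ (deriv (deriv p)) s)
    (hppos : ∀ s ∈ Set.Ioo α β, 0 < p s)
    (hp' : ∀ s ∈ Set.Ioo α β, deriv p s ≠ 0)
    (hwdiff : ∀ s ∈ Set.Ioo α β, DifferentiableAt ℝ w s)
    (hwdiff2 : ∀ s ∈ Set.Ioo α β, DifferentiableAt ℝ (deriv w) s)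
    (hwpos : ∀ s ∈ Set.Ioo α β, 0 < w s)
    (hw' : ∃ s ∈ Set.Ioo α β, deriv w s ≠ 0)
    (heq1 : ∀ s ∈ Set.Ioo α β,
      deriv p s / p s * deriv w s
        = w s / (m : ℝ) * (-(2 * deriv (deriv p) s) / p s - lam))
    (heq2 : ∀ s ∈ Set.Ioo α β,
      deriv (deriv p) s / deriv p s * deriv w s = deriv (deriv w) s)
    (heq3 : ∀ s ∈ Set.Ioo α β,
      deriv (deriv w) s
        = w s / (m : ℝ) * (-(deriv (deriv p) s) / p s
            - deriv (deriv (deriv p)) s / deriv p s - lam)) :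
    (∃ c₁ : ℝ, 0 < c₁ ∧ ∀ s ∈ Set.Ioo α β, w s = c₁ * p s) ∧
    (∃ a : ℝ, ∀ s ∈ Set.Ioo α β,
      (deriv p s) ^ 2 + lam / ((m : ℝ) + 2) * (p s) ^ 2 + 2 * a / (m : ℝ) * (p s) ^ (-(m : ℤ))
        = 0) := by
  have hm0 : (m : ℝ) ≠ 0 := by positivity
  have hm2 : (m : ℝ) + 2 ≠ 0 := by positivity
  have hp0 : ∀ s ∈ Set.Ioo α β, p s ≠ 0 := fun s hs => (hppos s hs).ne'
  obtain ⟨k, hk⟩ : ∃ k, ∀ s ∈ Set.Ioo α β, deriv w s / deriv p s = k := by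
    refine exists_const_of_hasDerivAt_zero_Ioo fun s hs => ?_
    refine ((hwdiff2 s hs).hasDerivAt.div (hpdiff2 s hs).hasDerivAt (hp' s hs)).congr_deriv ?_
    have h := hp' s hs
    rw [← heq2 s hs]
    field_simp
    ring
  have hkw : ∀ s ∈ Set.Ioo α β, deriv w s = k * deriv p s := fun s hs =>
    (div_eq_iff (hp' s hs)).1 (hk s hs)
  obtain ⟨s₀, hs₀, hws₀⟩ := hw'
  have hk0 : k ≠ 0 := by
    rintro rfl
    exact hws₀ (by rw [hkw s₀ hs₀, zero_mul])
  obtain ⟨d, hd⟩ : ∃ d, ∀ s ∈ Set.Ioo α β, w s - k * p s = d := by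
    refine exists_const_of_hasDerivAt_zero_Ioo fun s hs => ?_
    refine ((hwdiff s hs).hasDerivAt.sub
      ((hpdiff s hs).hasDerivAt.const_mul k)).congr_deriv ?_
    rw [hkw s hs, sub_self]
  have h1 : ∀ s ∈ Set.Ioo α β,
      m * k * deriv p s ^ 2 + w s * (2 * deriv (deriv p) s + lam * p s) = 0 := by
    intro s hs
    have h := heq1 s hs
    have := hp0 s hs
    rw [hkw s hs] at h
    field_simp at h
    linear_combination h
  have h1' : ∀ s ∈ Set.Ioo α β,
      2 * m * k * deriv p s * deriv (deriv p) s
        + k * deriv p s * (2 * deriv (deriv p) s + lam * p s)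
        + w s * (2 * deriv (deriv (deriv p)) s + lam * deriv p s) = 0 := by
    intro s hs
    have hG := (((hpdiff2 s hs).hasDerivAt.pow 2).const_mul (m * k)).add
      ((hwdiff s hs).hasDerivAt.mul
        (((hpdiff3 s hs).hasDerivAt.const_mul 2).add ((hpdiff s hs).hasDerivAt.const_mul lam)))
    have h0 := hG.unique ((hasDerivAt_const s (0 : ℝ)).congr_of_eventuallyEq
      (Filter.eventuallyEq_of_mem (isOpen_Ioo.mem_nhds hs) h1))
    simp only [Pi.add_apply] at h0
    rw [hkw s hs] at h0
    norm_num at h0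
    linear_combination h0
  have hprod : ∀ s ∈ Set.Ioo α β,
      (2 * deriv (deriv p) s + lam * p s) * (w s - k * p s) = 0 := by
    intro s hs
    have h3 := heq3 s hs
    have hp := hp0 s hs
    have hq := hp' s hs
    rw [← heq2 s hs, hkw s hs] at h3
    field_simp at h3
    refine (mul_eq_zero.1 (?_ : deriv p s * _ = 0)).resolve_left hq
    linear_combination 2 * h3 - p s * h1' s hs
  have hd0 : d = 0 := by
    by_contra hne
    have h := (mul_eq_zero.1 (hprod s₀ hs₀)).resolve_right (by rwa [hd s₀ hs₀])
    have h' := h1 s₀ hs₀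
    rw [h, mul_zero, add_zero] at h'
    exact mul_ne_zero (mul_ne_zero hm0 hk0) (pow_ne_zero 2 (hp' s₀ hs₀)) h'
  have hw : ∀ s ∈ Set.Ioo α β, w s = k * p s := fun s hs =>
    sub_eq_zero.1 ((hd s hs).trans hd0)
  refine ⟨⟨k, ?_, hw⟩, ?_⟩
  · have h := hwpos s₀ hs₀
    rw [hw s₀ hs₀] at h
    exact pos_of_mul_pos_left h (hppos s₀ hs₀).le
  · obtain ⟨c, hc⟩ : ∃ c, ∀ s ∈ Set.Ioo α β,
        p s ^ m * (deriv p s ^ 2 + lam / ((m : ℝ) + 2) * p s ^ 2) = c := by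
      refine exists_const_of_hasDerivAt_zero_Ioo fun s hs => ?_
      refine (((hpdiff s hs).hasDerivAt.pow m).mul
        (((hpdiff2 s hs).hasDerivAt.pow 2).add
          (((hpdiff s hs).hasDerivAt.pow 2).const_mul (lam / ((m : ℝ) + 2))))).congr_deriv ?_
      have h : m * deriv p s ^ 2 + p s * (2 * deriv (deriv p) s + lam * p s) = 0 := by
        refine (mul_eq_zero.1 (?_ : k * _ = 0)).resolve_left hk0
        have h := h1 s hs
        rw [hw s hs] at h
        linear_combination h
      obtain ⟨n, rfl⟩ : ∃ n, m = n + 1 := ⟨m - 1, by omega⟩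
      simp only [Pi.add_apply, Pi.pow_apply, Nat.add_sub_cancel]
      norm_num
      push_cast at h hm2
      field_simp
      linear_combination (p s ^ n * deriv p s * ((n : ℝ) + 1 + 2)) * h
    refine ⟨-(m * c / 2), fun s hs => ?_⟩
    have hp := hp0 s hs
    rw [← hc s hs, zpow_neg, zpow_natCast]
    field_simp
    ring
end

section
/- Let m ≥ 2 be an integer. Let J ⊆ ℝ be an open interval, and let w, h : J → ℝ be twice differentiable with w > 0, h > 0, and w' nowhere zero on J. Suppose that on J: w'' = (h'/h)·w' and (h'/h)·w' = −(w/m)·(h''/h). Then there exists a constant c ≠ 0 with h = c·w' on J, the function w^m·w'' is equal to a constant a on J, and the function (w')² + (2a/(m−1))w^{1−m} is constant on J. -/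
/-- A function with zero derivative on an open interval is constant there. -/
theorem exists_eq_const_of_hasDerivAt_zero_Ioo {f : ℝ → ℝ} {α β : ℝ}
    (hf : ∀ s ∈ Set.Ioo α β, HasDerivAt f 0 s) : ∃ C, ∀ s ∈ Set.Ioo α β, f s = C := by
  obtain ⟨C, hC⟩ := isOpen_Ioo.exists_is_const_of_deriv_eq_zero isPreconnected_Ioo
    (fun s hs => (hf s hs).differentiableAt.differentiableWithinAt)
    (fun s hs => (hf s hs).deriv)
  exact ⟨C, hC⟩

/-- For `m ≥ 2`: on an open interval `J = (α, β)`, let `w, h` be twice differentiable with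
`w > 0`, `h > 0`, `w'` nowhere zero, satisfying `w'' = (h'/h) w'` and
`(h'/h) w' = −(w/m)(h''/h)` on `J`. Then `h = c w'` on `J` for some constant `c ≠ 0`,
`w^m w''` equals a constant `a` on `J`, and `(w')² + (2a/(m−1)) w^(1−m)` is constant
on `J`. -/
theorem stmt_16 (m : ℕ) (hm : 2 ≤ m) (α β : ℝ)
    (w h : ℝ → ℝ)
    (hwdiff : ∀ s ∈ Set.Ioo α β, DifferentiableAt ℝ w s)
    (hwdiff2 : ∀ s ∈ Set.Ioo α β, DifferentiableAt ℝ (deriv w) s)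
    (hhdiff : ∀ s ∈ Set.Ioo α β, DifferentiableAt ℝ h s)
    (hhdiff2 : ∀ s ∈ Set.Ioo α β, DifferentiableAt ℝ (deriv h) s)
    (hwpos : ∀ s ∈ Set.Ioo α β, 0 < w s)
    (hhpos : ∀ s ∈ Set.Ioo α β, 0 < h s)
    (hw' : ∀ s ∈ Set.Ioo α β, deriv w s ≠ 0)
    (heq1 : ∀ s ∈ Set.Ioo α β, deriv (deriv w) s = deriv h s / h s * deriv w s)
    (heq2 : ∀ s ∈ Set.Ioo α β,
      deriv h s / h s * deriv w s = -(w s / (m : ℝ)) * (deriv (deriv h) s / h s)) :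
    (∃ c : ℝ, c ≠ 0 ∧ ∀ s ∈ Set.Ioo α β, h s = c * deriv w s) ∧
    (∃ a : ℝ, (∀ s ∈ Set.Ioo α β, (w s) ^ m * deriv (deriv w) s = a) ∧
      ∃ C : ℝ, ∀ s ∈ Set.Ioo α β,
        (deriv w s) ^ 2 + 2 * a / ((m : ℝ) - 1) * (w s) ^ ((1 : ℤ) - (m : ℤ)) = C) := by
  have hm0 : (m : ℝ) ≠ 0 := by positivity
  have hm1 : (m : ℝ) - 1 ≠ 0 := by
    have : (2 : ℝ) ≤ m := by exact_mod_cast hm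
    linarith
  have hc : ∃ c : ℝ, c ≠ 0 ∧ ∀ s ∈ Set.Ioo α β, h s = c * deriv w s := by
    obtain ⟨c, hc⟩ := exists_eq_const_of_hasDerivAt_zero_Ioo (f := fun s => h s / deriv w s)
      (α := α) (β := β) (fun s hs => by
        have hh := (hhpos s hs).ne'
        refine ((hhdiff s hs).hasDerivAt.fun_div (hwdiff2 s hs).hasDerivAt (hw' s hs)).congr_deriv ?_
        rw [heq1 s hs]
        field_simp
        ring)
    rcases (Set.Ioo α β).eq_empty_or_nonempty with he | ⟨t, ht⟩
    · exact ⟨1, one_ne_zero, by simp [he]⟩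
    · refine ⟨c, ?_, fun s hs => ?_⟩
      · rw [← hc t ht]
        exact div_ne_zero (hhpos t ht).ne' (hw' t ht)
      · rw [← hc s hs, div_mul_cancel₀ _ (hw' s hs)]
  refine ⟨hc, ?_⟩
  obtain ⟨c, hc0, hc⟩ := hc
  have hderiv : ∀ s ∈ Set.Ioo α β, deriv h s = c * deriv (deriv w) s := fun s hs => by
    have hev : h =ᶠ[nhds s] fun t => c * deriv w t :=
      Filter.eventuallyEq_of_mem (isOpen_Ioo.mem_nhds hs) hc
    rw [hev.deriv_eq, deriv_const_mul _ (hwdiff2 s hs)]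
  obtain ⟨b, hb⟩ := exists_eq_const_of_hasDerivAt_zero_Ioo (f := fun s => w s ^ m * deriv h s)
    (α := α) (β := β) (fun s hs => by
      have hh := (hhpos s hs).ne'
      have heq := heq2 s hs
      field_simp at heq
      refine (((hwdiff s hs).hasDerivAt.fun_pow m).fun_mul (hhdiff2 s hs).hasDerivAt).congr_deriv ?_
      obtain ⟨n, rfl⟩ : ∃ n, m = n + 1 := ⟨m - 1, by omega⟩
      rw [Nat.add_sub_cancel, pow_succ]
      linear_combination w s ^ n * heq)
  have ha : ∀ s ∈ Set.Ioo α β, w s ^ m * deriv (deriv w) s = b / c := fun s hs => by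
    rw [← hb s hs, hderiv s hs]
    field_simp
  refine ⟨b / c, ha, exists_eq_const_of_hasDerivAt_zero_Ioo fun s hs => ?_⟩
  have hw0 := (hwpos s hs).ne'
  have hpow := (hasDerivAt_zpow (1 - (m : ℤ)) (w s) (Or.inl hw0)).comp s (hwdiff s hs).hasDerivAt
  refine (((hwdiff2 s hs).hasDerivAt.fun_pow 2).fun_add
    (hpow.const_mul (2 * (b / c) / ((m : ℝ) - 1)))).congr_deriv ?_
  rw [← ha s hs, show (1 - (m : ℤ) - 1) = -(m : ℤ) by ring, zpow_neg, zpow_natCast]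
  push_cast
  field_simp
  ring
end
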